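/- Let k be a complex number, let y be a point of three-dimensional Euclidean space, and define u : ℝ³ \ {y} → ℂ by u(x) = exp(i·k·‖x−y‖) / (4π‖x−y‖). Then for every x ≠ y, the function u satisfies the Helmholtz equation Δu(x) + k²·u(x) = 0, where Δ denotes the Laplacian (the trace of the second derivative, i.e. the sum of the second partial derivatives) on ℝ³. -/

import Mathlib

/-- The gradient of the distance to `y`, away from `y`. -/
theorem hasFDerivAt_norm_sub {E : Type*} [NormedAddCommGroup E] [InnerProductSpace ℝ E]
    {x y : E} (h : x ≠ y) :
    HasFDerivAt (fun z => ‖z - y‖) (‖x - y‖⁻¹ • innerSL ℝ (x - y)) x := by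
  have hr : ‖x - y‖ ≠ 0 := norm_ne_zero_iff.mpr (sub_ne_zero.mpr h)
  have hsq : HasFDerivAt (fun z => ‖z - y‖ ^ 2) (2 • innerSL ℝ (x - y)) x := by
    simpa using ((hasFDerivAt_id x).sub_const y).norm_sq
  have hsqrt := hsq.sqrt (pow_ne_zero 2 hr)
  simp only [Real.sqrt_sq (norm_nonneg _)] at hsqrt
  convert hsqrt using 1
  ext v
  simp
  field_simp

/-- The derivative of a radial function, away from its centre. -/
theorem HasDerivAt.hasFDerivAt_comp_norm_sub {E F : Type*} [NormedAddCommGroup E]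
    [InnerProductSpace ℝ E] [NormedAddCommGroup F] [NormedSpace ℝ F]
    {f : ℝ → F} {f' : F} {x y : E} (h : x ≠ y) (hf : HasDerivAt f f' ‖x - y‖) :
    HasFDerivAt (fun z => f ‖z - y‖)
      ((‖x - y‖⁻¹ • innerSL ℝ (x - y)).smulRight f') x := by
  refine (hf.hasFDerivAt.comp x (hasFDerivAt_norm_sub h)).congr_fderiv ?_
  ext v
  simp [smul_smul, sub_smul, smul_sub]

/-- If `f' r = r • g r`, then the sum of the second partial derivatives of the radial function
with profile `f` is `n • g r + r • g' r`. -/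
theorem sum_fderiv_fderiv_radial {ι F : Type*} [Fintype ι] [DecidableEq ι]
    [NormedAddCommGroup F] [NormedSpace ℝ F]
    {u : EuclideanSpace ℝ ι → F} {f g : ℝ → F} {g' : F} {x y : EuclideanSpace ℝ ι}
    (h : x ≠ y) (hu : ∀ z, z ≠ y → u z = f ‖z - y‖)
    (hf : ∀ r, 0 < r → HasDerivAt f (r • g r) r) (hg : HasDerivAt g g' ‖x - y‖) :
    ∑ i, fderiv ℝ (fun z => fderiv ℝ u z (EuclideanSpace.single i (1 : ℝ))) x
        (EuclideanSpace.single i (1 : ℝ)) =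
      (Fintype.card ι : ℝ) • g ‖x - y‖ + ‖x - y‖ • g' := by
  have hr : ‖x - y‖ ≠ 0 := norm_ne_zero_iff.mpr (sub_ne_zero.mpr h)
  have fderiv_single (i : ι) (z : EuclideanSpace ℝ ι) (hz : z ≠ y) :
      fderiv ℝ u z (EuclideanSpace.single i (1 : ℝ)) = (z i - y i) • g ‖z - y‖ := by
    have hzr : 0 < ‖z - y‖ := norm_pos_iff.mpr (sub_ne_zero.mpr hz)
    have hloc : u =ᶠ[nhds z] fun w => f ‖w - y‖ := by
      filter_upwards [isOpen_ne.mem_nhds hz] with w hw using hu w hw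
    rw [hloc.fderiv_eq, ((hf _ hzr).hasFDerivAt_comp_norm_sub hz).fderiv]
    simp [EuclideanSpace.inner_single_right, smul_smul]
    congr 1
    field_simp
  have fderiv_fderiv_single (i : ι) :
      fderiv ℝ (fun z => fderiv ℝ u z (EuclideanSpace.single i (1 : ℝ))) x
        (EuclideanSpace.single i (1 : ℝ)) =
      g ‖x - y‖ + ((x i - y i) ^ 2 * ‖x - y‖⁻¹) • g' := by
    have hloc : (fun z => fderiv ℝ u z (EuclideanSpace.single i (1 : ℝ))) =ᶠ[nhds x]
        fun z => (z i - y i) • g ‖z - y‖ := by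
      filter_upwards [isOpen_ne.mem_nhds h] with z hz using fderiv_single i z hz
    have hcoord : HasFDerivAt (fun z : EuclideanSpace ℝ ι => z i - y i)
        (EuclideanSpace.proj i : EuclideanSpace ℝ ι →L[ℝ] ℝ) x :=
      (EuclideanSpace.proj i : EuclideanSpace ℝ ι →L[ℝ] ℝ).hasFDerivAt.sub_const (y i)
    rw [hloc.fderiv_eq, (hcoord.fun_smul (hg.hasFDerivAt_comp_norm_sub h)).fderiv]
    simp [EuclideanSpace.inner_single_right, smul_smul]
    rw [add_comm]
    congr 2
    ring
  have hnorm : ∑ i, (x i - y i) ^ 2 = ‖x - y‖ ^ 2 := by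
    simp [EuclideanSpace.norm_sq_eq]
  simp_rw [fderiv_fderiv_single]
  rw [Finset.sum_add_distrib, ← Finset.sum_smul, ← Finset.sum_mul, hnorm]
  congr 1
  · simp [Nat.cast_smul_eq_nsmul]
  · congr 1
    field_simp

/-- The 3D Helmholtz Green's function `u x = exp(i k ‖x-y‖)/(4π‖x-y‖)` satisfies the
Helmholtz equation `Δu + k² u = 0` at every point `x ≠ y`, where the Laplacian is
the sum of the second partial derivatives on ℝ³. -/
theorem helmholtz_green_satisfies_helmholtz
    (k : ℂ) (y : EuclideanSpace ℝ (Fin 3)) (u : EuclideanSpace ℝ (Fin 3) → ℂ)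
    (hu : ∀ x, x ≠ y →
      u x = Complex.exp (Complex.I * k * (‖x - y‖ : ℝ)) / (4 * Real.pi * (‖x - y‖ : ℝ))) :
    ∀ x, x ≠ y →
      (∑ i : Fin 3,
        fderiv ℝ (fun z => fderiv ℝ u z (EuclideanSpace.single i (1 : ℝ))) x
          (EuclideanSpace.single i (1 : ℝ)))
        + k ^ 2 * u x = 0 := by
  intro x hx
  have hpi : (Real.pi : ℂ) ≠ 0 := Complex.ofReal_ne_zero.mpr Real.pi_ne_zero
  have hexp (r : ℝ) : HasDerivAt (fun s : ℝ => Complex.exp (Complex.I * k * s))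
      (Complex.exp (Complex.I * k * r) * (Complex.I * k)) r := by
    simpa using ((Complex.ofRealCLM.hasDerivAt (x := r)).const_mul (Complex.I * k)).cexp
  have hid (r : ℝ) : HasDerivAt (fun s : ℝ => (s : ℂ)) 1 r := by
    exact (hasDerivAt_id r).ofReal_comp.congr_deriv Complex.ofReal_one
  have hf (r : ℝ) (hr : 0 < r) :
      HasDerivAt (fun s : ℝ => Complex.exp (Complex.I * k * s) / (4 * Real.pi * s))
        (r • (Complex.exp (Complex.I * k * r) * (Complex.I * k * r - 1) /
          (4 * Real.pi * r ^ 3))) r := by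
    have hr' : (r : ℂ) ≠ 0 := Complex.ofReal_ne_zero.mpr hr.ne'
    refine ((hexp r).fun_div ((hid r).const_mul (4 * Real.pi : ℂ))
      (by simp [hpi, hr'])).congr_deriv ?_
    rw [Complex.real_smul]
    field_simp
  have hr : (‖x - y‖ : ℂ) ≠ 0 :=
    Complex.ofReal_ne_zero.mpr (norm_ne_zero_iff.mpr (sub_ne_zero.mpr hx))
  have hg : HasDerivAt (fun s : ℝ => Complex.exp (Complex.I * k * s) * (Complex.I * k * s - 1) /
        (4 * Real.pi * s ^ 3))
      (Complex.exp (Complex.I * k * ‖x - y‖) *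
        (3 - 3 * Complex.I * k * ‖x - y‖ - k ^ 2 * ‖x - y‖ ^ 2) /
          (4 * Real.pi * ‖x - y‖ ^ 4)) ‖x - y‖ := by
    refine (((hexp ‖x - y‖).fun_mul (((hid _).const_mul (Complex.I * k)).sub_const 1)).fun_div
      (((hid _).fun_pow 3).const_mul (4 * Real.pi : ℂ)) (by simp [hpi, hr])).congr_deriv ?_
    field_simp
    linear_combination (k ^ 2 * ‖x - y‖ ^ 4 : ℂ) * Complex.I_sq
  rw [sum_fderiv_fderiv_radial hx hu hf hg, hu x hx]
  simp only [Complex.real_smul, Fintype.card_fin]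
  push_cast
  field_simp
  ring
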